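/- Let C be a finite group all of whose Sylow subgroups are cyclic (a Z-group). Then C is metacyclic, in particular supersolvable, and hence C has a Sylow tower. -/

import Mathlib

/-- A finite group `G` is supersolvable: it has a normal series with cyclic
factors (each `H_{i+1}` is generated modulo `H_i` by a single element). -/
def IsSupersolvable (G : Type*) [Group G] : Prop :=
  ∃ n : ℕ, ∃ H : Fin (n + 1) → Subgroup G,
    H 0 = ⊥ ∧ H (Fin.last n) = ⊤ ∧
    (∀ i : Fin n, H i.castSucc ≤ H i.succ) ∧ (∀ i, (H i).Normal) ∧
    ∀ i : Fin n, ∃ x ∈ H i.succ, ∀ y ∈ H i.succ, ∃ k : ℤ,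
      (x ^ k)⁻¹ * y ∈ H i.castSucc

/-- A finite group `G` has a Sylow tower: an ascending chain of normal subgroups
`⊥ = T₀ ≤ T₁ ≤ ⋯ ≤ T_r = ⊤` such that each factor `T_{i+1}/T_i` is a Sylow
`p_i`-subgroup of `G/T_i`. -/
def HasSylowTower (G : Type*) [Group G] : Prop :=
  ∃ r : ℕ, ∃ T : Fin (r + 1) → Subgroup G,
    T 0 = ⊥ ∧ T (Fin.last r) = ⊤ ∧
    (∀ i : Fin r, T i.castSucc ≤ T i.succ) ∧ (∀ i, (T i).Normal) ∧
    ∃ p : Fin r → ℕ, ∀ i : Fin r, (p i).Prime ∧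
      (∃ a : ℕ, Nat.card (T i.succ) = Nat.card (T i.castSucc) * p i ^ a) ∧
      ¬ p i ∣ (T i.succ).index

/-- A Sylow subgroup of a finite group is contained in every normal subgroup whose index is not
divisible by the prime. -/
theorem Sylow.le_of_not_dvd_index {G : Type*} [Group G] [Finite G] {p : ℕ} [Fact p.Prime]
    (P : Sylow p G) {N : Subgroup G} [N.Normal] (h : ¬ p ∣ N.index) :
    (P : Subgroup G) ≤ N := by
  have hcop : (Nat.card P).Coprime N.index := by
    obtain ⟨k, hk⟩ := P.2.exists_card_eq
    rw [hk]
    exact ((Fact.out : p.Prime).coprime_iff_not_dvd.mpr h).pow_left k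
  rw [← QuotientGroup.ker_mk' N, ← Subgroup.map_eq_bot_iff, ← Subgroup.card_eq_one]
  exact Nat.eq_one_of_dvd_coprimes hcop
    (Subgroup.card_map_dvd _ _) (Subgroup.card_subgroup_dvd_card _)

/-- A Sylow subgroup contained in an abelian normal subgroup is normal. -/
theorem Sylow.normal_of_le_of_isMulCommutative {G : Type*} [Group G] [Finite G] {p : ℕ}
    [Fact p.Prime] (P : Sylow p G) {N : Subgroup G} [N.Normal] [IsMulCommutative N]
    (h : (P : Subgroup G) ≤ N) : (P : Subgroup G).Normal := by
  have : (P.subtype h : Subgroup N).Normal := by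
    refine ⟨fun x hx g ↦ ?_⟩
    rwa [mul_comm' g x, mul_inv_cancel_right]
  have := Sylow.characteristic_of_normal (P.subtype h) this
  have hmap := ConjAct.normal_of_characteristic_of_normal (H := N) (K := P.subtype h)
  rwa [Sylow.coe_subtype, Subgroup.map_subgroupOf_eq_of_le h] at hmap

/-- A nontrivial finite Z-group has a nontrivial normal Sylow subgroup. -/
theorem IsZGroup.exists_sylow_normal (G : Type*) [Group G] [Finite G] [IsZGroup G]
    [Nontrivial G] :
    ∃ (p : ℕ) (_ : Fact p.Prime) (P : Sylow p G), (P : Subgroup G) ≠ ⊥ ∧ P.Normal := by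
  have := IsZGroup.isCyclic_commutator G
  by_cases h : commutator G = ⊥
  · obtain ⟨p, hp, hdvd⟩ := Nat.exists_prime_and_dvd (Finite.one_lt_card (α := G)).ne'
    have := Fact.mk hp
    let P : Sylow p G := default
    refine ⟨p, this, P, P.ne_bot_of_dvd_card hdvd, ?_⟩
    exact Subgroup.Normal.of_commutator_le _ (h.trans_le bot_le)
  · obtain ⟨p, hp, hdvd⟩ := Nat.exists_prime_and_dvd (mt Subgroup.card_eq_one.mp h)
    have := Fact.mk hp
    let P : Sylow p G := default
    refine ⟨p, this, P, P.ne_bot_of_dvd_card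
      (hdvd.trans (Subgroup.card_subgroup_dvd_card _)), ?_⟩
    refine P.normal_of_le_of_isMulCommutative (N := commutator G) (P.le_of_not_dvd_index ?_)
    exact fun hi ↦ Nat.not_coprime_of_dvd_of_dvd hp.one_lt hdvd hi
      (IsZGroup.coprime_commutator_index G)

/-- A Sylow tower of the quotient by a normal Sylow subgroup lifts to a Sylow tower. -/
theorem HasSylowTower.of_quotient_sylow {G : Type*} [Group G] [Finite G] {p : ℕ}
    [hp : Fact p.Prime] (P : Sylow p G) [P.Normal] (h : HasSylowTower (G ⧸ (P : Subgroup G))) :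
    HasSylowTower G := by
  obtain ⟨r, T, h0, hlast, hle, hnormal, q, hq⟩ := h
  let π := QuotientGroup.mk' (P : Subgroup G)
  have hπ : Function.Surjective π := QuotientGroup.mk'_surjective _
  have hcard (K : Subgroup (G ⧸ (P : Subgroup G))) :
      Nat.card (K.comap π) = Nat.card (P : Subgroup G) * Nat.card K := by
    refine mul_right_cancel₀ K.index_ne_zero_of_finite ?_
    rw [mul_assoc, K.card_mul_index, ← Subgroup.index_eq_card, Subgroup.card_mul_index,
      ← Subgroup.index_comap_of_surjective K hπ, Subgroup.card_mul_index]
  have hbot : (⊥ : Subgroup (G ⧸ (P : Subgroup G))).comap π = P := by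
    rw [MonoidHom.comap_bot, QuotientGroup.ker_mk']
  refine ⟨r + 1, Fin.cons ⊥ fun i ↦ (T i).comap π, rfl, ?_, ?_, ?_, Fin.cons p q, ?_⟩
  · rw [← Fin.succ_last, Fin.cons_succ, hlast, Subgroup.comap_top]
  · refine Fin.cases bot_le fun i ↦ ?_
    rw [Fin.castSucc_succ, Fin.cons_succ, Fin.cons_succ]
    exact Subgroup.comap_mono (hle i)
  · exact Fin.cases (inferInstanceAs (⊥ : Subgroup G).Normal) fun i ↦ (hnormal i).comap π
  · refine Fin.cases ⟨hp.out, ?_, ?_⟩ fun i ↦ ⟨(hq i).1, ?_, ?_⟩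
    · obtain ⟨a, ha⟩ := P.2.exists_card_eq
      refine ⟨a, ?_⟩
      simpa [h0, hbot] using ha
    · simpa [h0, hbot] using P.not_dvd_index
    · obtain ⟨a, ha⟩ := (hq i).2.1
      refine ⟨a, ?_⟩
      rw [Fin.castSucc_succ, Fin.cons_succ, Fin.cons_succ, Fin.cons_succ, hcard, hcard, ha,
        mul_assoc]
    · rw [Fin.cons_succ, Fin.cons_succ, Subgroup.index_comap_of_surjective _ hπ]
      exact (hq i).2.2

theorem HasSylowTower.of_subsingleton (G : Type*) [Group G] [Subsingleton G] :
    HasSylowTower G :=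
  ⟨0, fun _ ↦ ⊥, rfl, Subsingleton.elim _ _, fun i ↦ i.elim0, fun _ ↦ inferInstance,
    fun i ↦ i.elim0, fun i ↦ i.elim0⟩

/-- A finite Z-group has a Sylow tower. -/
theorem IsZGroup.hasSylowTower (G : Type*) [Group G] [Finite G] [IsZGroup G] :
    HasSylowTower G := by
  induction hn : Nat.card G using Nat.strong_induction_on generalizing G with
  | _ n ih =>
    subst hn
    cases subsingleton_or_nontrivial G
    · exact .of_subsingleton G
    · obtain ⟨p, hp, P, hP, hPn⟩ := IsZGroup.exists_sylow_normal G
      have := hPn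
      refine .of_quotient_sylow P (ih _ ?_ _ rfl)
      rw [← (P : Subgroup G).card_mul_index]
      exact lt_mul_of_one_lt_left Nat.card_pos ((P : Subgroup G).one_lt_card_iff_ne_bot.mpr hP)

/-- An extension of a cyclic group by a cyclic group is supersolvable. -/
theorem IsSupersolvable.of_isCyclic_of_isCyclic_quotient {G : Type*} [Group G] (N : Subgroup G)
    [N.Normal] [IsCyclic N] [IsCyclic (G ⧸ N)] : IsSupersolvable G := by
  refine ⟨2, ![⊥, N, ⊤], rfl, rfl, ?_, ?_, ?_⟩
  · simp [Fin.forall_fin_two]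
  · intro i
    fin_cases i
    exacts [inferInstanceAs (⊥ : Subgroup G).Normal, ‹N.Normal›,
      inferInstanceAs (⊤ : Subgroup G).Normal]
  · obtain ⟨⟨g, hg⟩, hgN⟩ := IsCyclic.exists_generator (α := N)
    obtain ⟨x, hx⟩ := IsCyclic.exists_generator (α := G ⧸ N)
    obtain ⟨x, rfl⟩ := QuotientGroup.mk_surjective x
    rw [Fin.forall_fin_two]
    refine ⟨⟨g, hg, fun y hy ↦ ?_⟩, ⟨x, trivial, fun y _ ↦ ?_⟩⟩
    · obtain ⟨k, hk⟩ := hgN ⟨y, hy⟩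
      have hk : g ^ k = y := congrArg Subtype.val hk
      exact ⟨k, by simp [hk]⟩
    · obtain ⟨k, hk⟩ := hx y
      exact ⟨k, QuotientGroup.eq.mp hk⟩

/-- A finite group all of whose Sylow subgroups are cyclic (a Z-group) is
metacyclic (it has a cyclic normal subgroup with cyclic quotient), in particular
supersolvable, and hence has a Sylow tower. -/
theorem zgroup_metacyclic_supersolvable_sylow_tower {C : Type*} [Group C]
    [Fintype C]
    (hZ : ∀ (p : ℕ) (_ : p.Prime) (P : Sylow p C), IsCyclic ↥(P : Subgroup C)) :
    (∃ H : Subgroup C, ∃ hn : H.Normal, IsCyclic ↥H ∧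
        (letI := hn; IsCyclic (C ⧸ H))) ∧
      IsSupersolvable C ∧ HasSylowTower C := by
  have : IsZGroup C := ⟨hZ⟩
  have hN : IsCyclic (commutator C) := IsZGroup.isCyclic_commutator C
  have hQ : IsCyclic (C ⧸ commutator C) := IsZGroup.isCyclic_abelianization (G := C)
  exact ⟨⟨commutator C, inferInstance, hN, hQ⟩,
    .of_isCyclic_of_isCyclic_quotient (commutator C), IsZGroup.hasSylowTower C⟩
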